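/- arXiv:1304.2332 — 4 statements merged into one kernel-verified Lean document; each statement's English description precedes it below -/
import Mathlib

section
/- For every (q,p)∈ℝ² and every x∈ℝ, the periodized Gaussian satisfies the identity Σ_{n∈ℤ} η_{qp}(x−2nl) = (πα²/(2l⁴))^{1/4} · Σ_{k∈ℤ} exp(−α²·(πk/l − p/ℏ)² + i·(π/l)·k·(x−q)), giving the expansion of the coherent state υ_{qp} with respect to the orthonormal basis e_k(x) = (2l)^{-1/2} exp(iπkx/l) of L²(−l,l;ℂ). -/
open MeasureTheory Filter Complex Real
open scoped ComplexConjugate Topology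

/-- The Gaussian wave packet `η_{qp}` on the line. -/
noncomputable def eta (hbar α q p : ℝ) (x : ℝ) : ℂ :=
  (((2 * Real.pi * α ^ 2) ^ (-(1 / 4 : ℝ)) : ℝ) : ℂ) *
    Complex.exp (((-(x - q) ^ 2 / (4 * α ^ 2) : ℝ) : ℂ)
      + Complex.I * (p : ℂ) * ((x - q : ℝ) : ℂ) / (hbar : ℂ))

/-- The freely evolved Gaussian wave packet `η_{qp,t}` on the line, with
`γ = ℏ t / (2 m α²)` and principal branches. -/
noncomputable def etaT (m hbar α q p t : ℝ) (x : ℝ) : ℂ :=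
  ((2 * (Real.pi : ℂ) * (α : ℂ) ^ 2) *
      (1 + Complex.I * ((hbar * t / (2 * m * α ^ 2) : ℝ) : ℂ)) ^ 2) ^ (-(1 / 4 : ℂ)) *
    Complex.exp (-((x - q - p * t / m : ℝ) : ℂ) ^ 2 /
        (4 * (α : ℂ) ^ 2 * (1 + Complex.I * ((hbar * t / (2 * m * α ^ 2) : ℝ) : ℂ)))
      + Complex.I * (p : ℂ) * ((x - q - p * t / (2 * m) : ℝ) : ℂ) / (hbar : ℂ))

/-- The coherent state `υ_{qp}` on the circle of circumference `2l`. -/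
noncomputable def upsilon (l hbar α q p : ℝ) (x : ℝ) : ℂ :=
  ∑' n : ℤ, eta hbar α q p (x - 2 * (n : ℝ) * l)

/-- The evolved coherent state `υ_{qp,t}` on the circle. -/
noncomputable def upsilonT (l m hbar α q p t : ℝ) (x : ℝ) : ℂ :=
  ∑' n : ℤ, etaT m hbar α q p t (x - 2 * (n : ℝ) * l)

/-- The coherent state `ω_{qp}` in the box `[-l, l]`. -/
noncomputable def omega (l hbar α q p : ℝ) (x : ℝ) : ℂ :=
  ∑' n : ℤ, (-1 : ℂ) ^ n * eta hbar α q p ((-1 : ℝ) ^ n * (x - 2 * (n : ℝ) * l))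

/-- The evolved coherent state `ω_{qp,t}` in the box `[-l, l]`. -/
noncomputable def omegaT (l m hbar α q p t : ℝ) (x : ℝ) : ℂ :=
  ∑' n : ℤ, (-1 : ℂ) ^ n * etaT m hbar α q p t ((-1 : ℝ) ^ n * (x - 2 * (n : ℝ) * l))

/-- A circle test function: smooth, `2l`-periodic in `q`, rapidly decaying in `p`
together with all derivatives. -/
structure IsCircleTest (l : ℝ) (σ : ℝ × ℝ → ℝ) : Prop where
  smooth : ContDiff ℝ (⊤ : ℕ∞) σ
  periodic : ∀ q p : ℝ, σ (q + 2 * l, p) = σ (q, p)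
  decay : ∀ r s : ℕ, ∃ C : ℝ, ∀ q p : ℝ,
    (1 + p ^ 2) ^ ((r : ℝ) / 2) * ‖iteratedFDeriv ℝ s σ (q, p)‖ ≤ C

/-- A box test function: smooth, invariant under the reflection–translation symmetry
of the box, rapidly decaying in `p` together with all derivatives. -/
structure IsBoxTest (l : ℝ) (σ : ℝ × ℝ → ℝ) : Prop where
  smooth : ContDiff ℝ (⊤ : ℕ∞) σ
  symm : ∀ (n : ℤ) (q p : ℝ),
    σ ((-1 : ℝ) ^ n * (q + 2 * (n : ℝ) * l), (-1 : ℝ) ^ n * p) = σ (q, p)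
  decay : ∀ r s : ℕ, ∃ C : ℝ, ∀ q p : ℝ,
    (1 + p ^ 2) ^ ((r : ℝ) / 2) * ‖iteratedFDeriv ℝ s σ (q, p)‖ ≤ C

/-- A semiclassical sequence: `ℏ_n, α_n > 0`, `ℏ_n → 0`, `α_n → 0`, `ℏ_n/α_n → 0`. -/
structure IsSemiclassical (hbar α : ℕ → ℝ) : Prop where
  hbar_pos : ∀ n, 0 < hbar n
  alpha_pos : ∀ n, 0 < α n
  hbar_lim : Tendsto hbar atTop (𝓝 0)
  alpha_lim : Tendsto α atTop (𝓝 0)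
  ratio_lim : Tendsto (fun n => hbar n / α n) atTop (𝓝 0)


/-- The normalization identity `(2πα²)^{-1/4} · a^{-1/2} = (πα²/(2l⁴))^{1/4}` for
`a = l²/(πα²)`. -/
lemma rpow_normalization_eq {l α : ℝ} (hl : 0 < l) (hα : 0 < α) :
    (2 * Real.pi * α ^ 2) ^ (-(1 / 4 : ℝ)) * (1 / (l ^ 2 / (Real.pi * α ^ 2)) ^ (1 / 2 : ℝ)) =
      (Real.pi * α ^ 2 / (2 * l ^ 4)) ^ ((1 : ℝ) / 4) := by
  have hπ := Real.pi_pos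
  have h : (l ^ 2 / (Real.pi * α ^ 2)) ^ (1 / 2 : ℝ) =
      ((l ^ 2 / (Real.pi * α ^ 2)) ^ 2) ^ (1 / 4 : ℝ) := by
    rw [← Real.rpow_natCast_mul (by positivity)]
    norm_num
  rw [h, one_div (_ ^ _), ← Real.inv_rpow (by positivity), Real.rpow_neg (by positivity),
    ← Real.inv_rpow (by positivity), ← Real.mul_rpow (by positivity) (by positivity)]
  congr 1
  field_simp

/-- the periodized Gaussian identity giving the expansion of the circle
coherent state `υ_{qp}` in the orthonormal basis `e_k(x) = (2l)^{-1/2} exp(iπkx/l)`. -/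
theorem upsilon_basis_expansion
    (l hbar α : ℝ) (hl : 0 < l) (hh : 0 < hbar) (hα : 0 < α) (q p x : ℝ) :
    (∑' n : ℤ, eta hbar α q p (x - 2 * (n : ℝ) * l)) =
      (((Real.pi * α ^ 2 / (2 * l ^ 4)) ^ ((1 : ℝ) / 4) : ℝ) : ℂ) *
        ∑' k : ℤ, Complex.exp
          (((-(α ^ 2) * (Real.pi * (k : ℝ) / l - p / hbar) ^ 2 : ℝ) : ℂ)
            + Complex.I * ((Real.pi / l * (k : ℝ) * (x - q) : ℝ) : ℂ)) := by
  set y := x - q with hy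
  set a : ℝ := l ^ 2 / (Real.pi * α ^ 2) with ha
  set b : ℂ := (y * l / α ^ 2 - 2 * I * p * l / hbar) / (2 * Real.pi) with hb
  have ha_pos : 0 < a := by positivity
  have hlC : (l : ℂ) ≠ 0 := by exact_mod_cast hl.ne'
  have hhC : (hbar : ℂ) ≠ 0 := by exact_mod_cast hh.ne'
  have hαC : (α : ℂ) ≠ 0 := by exact_mod_cast hα.ne'
  have hπC : (Real.pi : ℂ) ≠ 0 := by exact_mod_cast Real.pi_ne_zero
  have haC : (a : ℂ) = l ^ 2 / (Real.pi * α ^ 2) := by rw [ha]; push_cast; rfl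
  set c : ℂ := -(y : ℂ) ^ 2 / (4 * α ^ 2) + I * p * y / hbar with hc
  have eta_eq (n : ℤ) : eta hbar α q p (x - 2 * (n : ℝ) * l) =
      (((2 * Real.pi * α ^ 2) ^ (-(1 / 4 : ℝ)) : ℝ) : ℂ) * cexp c *
        cexp (-Real.pi * a * n ^ 2 + 2 * Real.pi * b * n) := by
    rw [_root_.eta, mul_assoc _ (cexp c), ← Complex.exp_add, haC, hb, hc, hy]
    congr 2
    push_cast
    field_simp
    ring
  have dual_eq (n : ℤ) : cexp c * cexp (-Real.pi / a * (n + I * b) ^ 2) =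
      cexp (((-(α ^ 2) * (Real.pi * ((-n : ℤ) : ℝ) / l - p / hbar) ^ 2 : ℝ) : ℂ)
        + I * ((Real.pi / l * ((-n : ℤ) : ℝ) * y : ℝ) : ℂ)) := by
    rw [← Complex.exp_add, haC, hb, hc]
    congr 1
    push_cast
    field_simp
    ring_nf
    simp only [I_sq, I_pow_three, I_pow_four]
    ring
  have const_eq := congrArg ((↑) : ℝ → ℂ) (rpow_normalization_eq hl hα)
  rw [← ha, ofReal_mul, ofReal_div, ofReal_one, ofReal_cpow ha_pos.le] at const_eq
  push_cast at const_eq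
  simp_rw [eta_eq]
  rw [tsum_mul_left, Complex.tsum_exp_neg_quadratic (by simpa using ha_pos) b,
    ← (Equiv.neg ℤ).tsum_eq (fun k : ℤ => cexp (((-(α ^ 2) *
      (Real.pi * (k : ℝ) / l - p / hbar) ^ 2 : ℝ) : ℂ) + I * ((Real.pi / l * (k : ℝ) * y : ℝ) : ℂ)))]
  simp_rw [Equiv.neg_apply, ← dual_eq]
  rw [tsum_mul_left, ← const_eq]
  ring
end

section
/- For all (q,p), (q',p') ∈ ℝ² and t∈ℝ, the L²(ℝ)-inner product of a Gaussian packet with a freely evolved one equals (η_{qp}, η_{q'p',t}) = √(2/(2+iγ)) · exp( −(q'−q+(p'+p)t/(2m))²/(4α²(2+iγ)) − α²(p'−p)²/(2ℏ²) − i(p'+p)(q'−q)/(2ℏ) − i·t·(p'+p)²/(8mℏ) ), where γ = ℏt/(2mα²) and the principal branch of the square root is taken. -/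
open MeasureTheory Filter Complex Real
open scoped ComplexConjugate Topology

/-- The principal logarithm is additive on the open right half-plane. -/
lemma log_mul_of_re_pos {z w : ℂ} (hz : 0 < z.re) (hw : 0 < w.re) :
    Complex.log (z * w) = Complex.log z + Complex.log w := by
  have hz0 : z ≠ 0 := by rintro rfl; simp at hz
  have hw0 : w ≠ 0 := by rintro rfl; simp at hw
  have h1 := abs_lt.mp (Complex.abs_arg_lt_pi_div_two_iff.mpr (Or.inl hz))
  have h2 := abs_lt.mp (Complex.abs_arg_lt_pi_div_two_iff.mpr (Or.inl hw))
  exact Complex.log_mul hz0 hw0 ⟨by linarith [h1.1, h2.1], by linarith [h1.2, h2.2]⟩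

/-- The normalising constants of two Gaussians combine with their Gaussian integral. -/
lemma gaussian_prefactor {c : ℝ} (hc : 0 < c) {u w : ℂ} (hu : 0 < u.re) (hw : 0 < w.re) :
    ((c ^ (-(1 / 4 : ℝ)) : ℝ) : ℂ) * ((c : ℂ) * u ^ 2) ^ (-(1 / 4 : ℂ)) *
      ((c : ℂ) * (u * w)) ^ (1 / 2 : ℂ) = w ^ (1 / 2 : ℂ) := by
  have hc0 : (c : ℂ) ≠ 0 := by exact_mod_cast hc.ne'
  have hu0 : u ≠ 0 := by rintro rfl; simp at hu
  have hw0 : w ≠ 0 := by rintro rfl; simp at hw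
  rw [Complex.ofReal_cpow hc.le, Complex.cpow_def_of_ne_zero hc0,
    Complex.cpow_def_of_ne_zero (mul_ne_zero hc0 (pow_ne_zero 2 hu0)),
    Complex.cpow_def_of_ne_zero (mul_ne_zero hc0 (mul_ne_zero hu0 hw0)),
    Complex.cpow_def_of_ne_zero hw0, Complex.log_ofReal_mul hc (pow_ne_zero 2 hu0),
    Complex.log_ofReal_mul hc (mul_ne_zero hu0 hw0), log_mul_of_re_pos hu hw, sq,
    log_mul_of_re_pos hu hu, Complex.ofReal_log hc.le, ← Complex.exp_add, ← Complex.exp_add]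
  congr 1
  push_cast
  ring

/-- the explicit Gaussian overlap formula
`(η_{qp}, η_{q'p',t})` on the line, with `γ = ℏt/(2mα²)`. -/
theorem gaussian_overlap
    (m hbar α : ℝ) (hm : 0 < m) (hh : 0 < hbar) (hα : 0 < α)
    (q p q' p' t : ℝ) :
    (∫ x : ℝ, conj (eta hbar α q p x) * etaT m hbar α q' p' t x) =
      (2 / (2 + Complex.I * ((hbar * t / (2 * m * α ^ 2) : ℝ) : ℂ))) ^ ((1 : ℂ) / 2) *
        Complex.exp
          (-((q' - q + (p' + p) * t / (2 * m) : ℝ) : ℂ) ^ 2 /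
              (4 * (α : ℂ) ^ 2 * (2 + Complex.I * ((hbar * t / (2 * m * α ^ 2) : ℝ) : ℂ)))
            - ((α ^ 2 * (p' - p) ^ 2 / (2 * hbar ^ 2) : ℝ) : ℂ)
            - Complex.I * (((p' + p) * (q' - q) / (2 * hbar) : ℝ) : ℂ)
            - Complex.I * ((t * (p' + p) ^ 2 / (8 * m * hbar) : ℝ) : ℂ)) := by
  obtain ⟨γ, hγ⟩ : ∃ γ : ℝ, γ = hbar * t / (2 * m * α ^ 2) := ⟨_, rfl⟩
  have ht : t = 2 * m * α ^ 2 * γ / hbar := by rw [hγ]; field_simp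
  simp only [_root_.eta, etaT, ← hγ]
  have hu : 0 < (1 + Complex.I * (γ : ℂ)).re := by simp
  have hv : 0 < (2 + Complex.I * (γ : ℂ)).re := by simp
  obtain ⟨u, hu_def⟩ : ∃ u : ℂ, u = 1 + Complex.I * (γ : ℂ) := ⟨_, rfl⟩
  have hv_eq : 2 + Complex.I * (γ : ℂ) = 1 + u := by rw [hu_def]; ring
  rw [hv_eq] at hv ⊢
  rw [← hu_def] at hu ⊢
  have hu0 : u ≠ 0 := by rintro rfl; simp at hu
  have hv0 : 1 + u ≠ 0 := by intro h; simp [h] at hv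
  have hα0 : (α : ℂ) ≠ 0 := by exact_mod_cast hα.ne'
  have hh0 : (hbar : ℂ) ≠ 0 := by exact_mod_cast hh.ne'
  have hm0 : (m : ℂ) ≠ 0 := by exact_mod_cast hm.ne'
  have hw : 0 < (2 / (1 + u)).re := by
    rw [Complex.div_re]
    have := Complex.normSq_pos.mpr hv0
    simp only [Complex.re_ofNat, Complex.im_ofNat, zero_mul, zero_div, add_zero]
    positivity
  have hc : 0 < 2 * Real.pi * α ^ 2 := by positivity
  set A : ℂ := (((2 * Real.pi * α ^ 2) ^ (-(1 / 4 : ℝ)) : ℝ) : ℂ) with hA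
  set B : ℂ := ((2 * (Real.pi : ℂ) * (α : ℂ) ^ 2) * u ^ 2) ^ (-(1 / 4 : ℂ)) with hB
  set b : ℂ := -(1 + u⁻¹) * ((1 / (4 * α ^ 2) : ℝ) : ℂ) with hb_def
  have hb : b.re < 0 := by
    have h1 : 0 < (u⁻¹).re := by
      rw [Complex.inv_re]
      exact div_pos hu (Complex.normSq_pos.mpr hu0)
    rw [hb_def, Complex.re_mul_ofReal, Complex.neg_re, Complex.add_re, Complex.one_re]
    have : 0 < 1 / (4 * α ^ 2) := by positivity
    nlinarith
  set Q : ℂ := q' + p' * t / m with hQ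
  set c : ℂ := (q + Q * u⁻¹) / (2 * α ^ 2) + Complex.I * (p' - p) / hbar with hc_def
  set d : ℂ := -(q ^ 2 + Q ^ 2 * u⁻¹) / (4 * α ^ 2)
    + Complex.I * (p * q - p' * (q' + p' * t / (2 * m))) / hbar with hd
  have hint : ∀ x : ℝ,
      conj (A * Complex.exp (((-(x - q) ^ 2 / (4 * α ^ 2) : ℝ) : ℂ)
        + Complex.I * (p : ℂ) * ((x - q : ℝ) : ℂ) / (hbar : ℂ))) *
      (B * Complex.exp (-((x - q' - p' * t / m : ℝ) : ℂ) ^ 2 / (4 * (α : ℂ) ^ 2 * u)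
        + Complex.I * (p' : ℂ) * ((x - q' - p' * t / (2 * m) : ℝ) : ℂ) / (hbar : ℂ))) =
      A * B * Complex.exp (b * x ^ 2 + c * x + d) := by
    intro x
    rw [map_mul, ← Complex.exp_conj, hA, Complex.conj_ofReal, mul_mul_mul_comm, ← Complex.exp_add]
    congr 2
    simp only [map_add, map_mul, map_div₀, Complex.conj_ofReal, Complex.conj_I, hb_def, hc_def,
      hd, hQ]
    push_cast
    field_simp
    ring
  simp_rw [hint]
  rw [integral_const_mul, integral_cexp_quadratic hb, ← mul_assoc]
  congr 1
  · have hbase : (Real.pi : ℂ) / -b = ((2 * Real.pi * α ^ 2 : ℝ) : ℂ) * (u * (2 / (1 + u))) := by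
      have hv0' : u + 1 ≠ 0 := by rwa [add_comm]
      rw [hb_def]
      push_cast
      field_simp
      ring
    have := gaussian_prefactor hc hu hw
    rw [hbase, ← this]
    push_cast [hA, hB]
    rfl
  · congr 1
    have hv0' : u + 1 ≠ 0 := by rwa [add_comm]
    have hb' : b = -(1 + u) / (4 * α ^ 2 * u) := by
      rw [hb_def]; push_cast; field_simp; ring
    have hγu : (γ : ℂ) = Complex.I * (1 - u) := by
      rw [hu_def]; linear_combination (γ : ℂ) * Complex.I_sq
    have ht' : (t : ℂ) = 2 * m * α ^ 2 * (Complex.I * (1 - u)) / hbar := by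
      rw [← hγu, ht]; push_cast; ring
    rw [hb', hd, hc_def, hQ]
    push_cast
    rw [ht']
    field_simp
    ring_nf
    simp only [Complex.I_sq]
    ring
end

section
/- For every integer k, every (q,p)∈ℝ², and every t∈ℝ, ∫_{−l}^{l} υ_{qp,t}(x)·exp(iπkx/l) dx = exp(−i·ℏ·t·π²k²/(2m l²)) · ∫_{−l}^{l} υ_{qp}(x)·exp(iπkx/l) dx. (Thus the periodization of the freely evolved Gaussian packet coincides with the spectral evolution of υ_{qp} under the free Hamiltonian on the circle, whose eigenfunctions are exp(iπkx/l) with eigenvalues ℏ²π²k²/(2ml²).) -/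
open MeasureTheory Filter Complex Real
open scoped ComplexConjugate Topology

theorem hasSum_setIntegral_comp_add_zsmul {E : Type*} [NormedAddCommGroup E] [NormedSpace ℝ E]
    {G : ℝ → E} (hG : Integrable G) {T : ℝ} (hT : 0 < T) (a : ℝ) :
    HasSum (fun n : ℤ => ∫ x in Set.Ioc a (a + T), G (x + n • T)) (∫ x, G x) := by
  have h := hasSum_integral_iUnion (μ := volume) (f := G)
    (fun n : ℤ => measurableSet_Ioc (a := a + n • T) (b := a + (n + 1) • T))
    (Set.pairwise_disjoint_Ioc_add_zsmul a T) hG.integrableOn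
  rw [iUnion_Ioc_add_zsmul hT, setIntegral_univ] at h
  refine h.congr_fun fun n => ?_
  rw [← intervalIntegral.integral_of_le (by linarith),
    ← intervalIntegral.integral_of_le (by rw [add_smul, one_smul]; linarith),
    intervalIntegral.integral_comp_add_right]
  congr 1
  rw [add_smul, one_smul]
  ring

/-- Unfolding: integrating a periodization over one period gives the integral over the line. -/
theorem integral_tsum_comp_add_zsmul {E : Type*} [NormedAddCommGroup E] [NormedSpace ℝ E]
    {G : ℝ → E} (hG : Integrable G) {T : ℝ} (hT : 0 < T) (a : ℝ) :
    ∫ x in a..a + T, ∑' n : ℤ, G (x + n • T) = ∫ x, G x := by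
  rw [intervalIntegral.integral_of_le (by linarith),
    ← integral_tsum_of_summable_integral_norm
      (fun n => (hG.comp_add_right (n • T)).integrableOn)
      (hasSum_setIntegral_comp_add_zsmul hG.norm hT a).summable]
  exact (hasSum_setIntegral_comp_add_zsmul hG hT a).tsum_eq

theorem mul_sq_cpow_mul_cpow {A B : ℝ} (hA : 0 < A) (hB : 0 < B) {w : ℂ} (hw : 0 < w.re) :
    ((A : ℂ) * w ^ 2) ^ (-(1 / 4 : ℂ)) * ((B : ℂ) * w) ^ (1 / 2 : ℂ) =
      (A : ℂ) ^ (-(1 / 4 : ℂ)) * (B : ℂ) ^ (1 / 2 : ℂ) := by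
  have hw0 : w ≠ 0 := fun h => by simp [h] at hw
  have hA0 : (A : ℂ) ≠ 0 := by exact_mod_cast hA.ne'
  have hB0 : (B : ℂ) ≠ 0 := by exact_mod_cast hB.ne'
  have harg := abs_lt.1 (Complex.abs_arg_lt_pi_div_two_iff.2 (Or.inl hw))
  have hlog : Complex.log (w ^ 2) = 2 * Complex.log w := by
    rw [sq, Complex.log_mul hw0 hw0 ⟨by linarith [harg.1], by linarith [harg.2]⟩, two_mul]
  rw [Complex.cpow_def_of_ne_zero (by positivity), Complex.cpow_def_of_ne_zero (by positivity),
    Complex.cpow_def_of_ne_zero hA0, Complex.cpow_def_of_ne_zero hB0,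
    Complex.log_ofReal_mul hA (by positivity), Complex.log_ofReal_mul hB hw0, hlog,
    Complex.ofReal_log hA.le, Complex.ofReal_log hB.le, ← Complex.exp_add, ← Complex.exp_add]
  congr 1
  ring

theorem etaT_zero {α : ℝ} (hα : 0 < α) (m hbar q p x : ℝ) :
    etaT m hbar α q p 0 x = _root_.eta hbar α q p x := by
  have h : (0 : ℝ) ≤ 2 * Real.pi * α ^ 2 := by positivity
  rw [etaT, _root_.eta, Complex.ofReal_cpow h]
  push_cast
  simp

/-- The spread `1 + iγ` of the evolved packet. -/
noncomputable def spread (m hbar α t : ℝ) : ℂ :=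
  1 + Complex.I * ((hbar * t / (2 * m * α ^ 2) : ℝ) : ℂ)

theorem spread_re (m hbar α t : ℝ) : (spread m hbar α t).re = 1 := by
  rw [spread, Complex.add_re, Complex.one_re, Complex.re_mul_ofReal, Complex.I_re]; ring

theorem spread_ne_zero (m hbar α t : ℝ) : spread m hbar α t ≠ 0 := fun h => by
  simpa [h] using spread_re m hbar α t

theorem neg_inv_spread_re_neg {α : ℝ} (hα : 0 < α) (m hbar t : ℝ) :
    (-(1 / (4 * (α : ℂ) ^ 2 * spread m hbar α t))).re < 0 := by
  have h : (1 / (4 * (α : ℂ) ^ 2 * spread m hbar α t)) =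
      ((1 / (4 * α ^ 2) : ℝ) : ℂ) * (spread m hbar α t)⁻¹ := by
    push_cast
    rw [one_div, mul_inv, one_div]
  rw [h, Complex.neg_re, Complex.re_ofReal_mul, Complex.inv_re, spread_re]
  have := Complex.normSq_pos.2 (spread_ne_zero m hbar α t)
  rw [neg_lt_zero]
  positivity

theorem etaT_mul_cexp (m hbar α q p t κ x : ℝ) :
    etaT m hbar α q p t x * Complex.exp (Complex.I * κ * x) =
      ((2 * (Real.pi : ℂ) * (α : ℂ) ^ 2) * spread m hbar α t ^ 2) ^ (-(1 / 4 : ℂ)) *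
        Complex.exp (-(1 / (4 * (α : ℂ) ^ 2 * spread m hbar α t)) * (x : ℂ) ^ 2 +
          (2 * (q + p * t / m) / (4 * (α : ℂ) ^ 2 * spread m hbar α t) +
            Complex.I * (p / hbar + κ)) * x +
          (-(q + p * t / m) ^ 2 / (4 * (α : ℂ) ^ 2 * spread m hbar α t) -
            Complex.I * p * (q + p * t / (2 * m)) / hbar)) := by
  rw [etaT, ← spread, mul_assoc, ← Complex.exp_add]
  congr 2
  push_cast
  ring

theorem integrable_etaT_mul_cexp {α : ℝ} (hα : 0 < α) (m hbar q p t κ : ℝ) :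
    Integrable fun x : ℝ => etaT m hbar α q p t x * Complex.exp (Complex.I * κ * x) := by
  simp_rw [etaT_mul_cexp]
  exact (integrable_cexp_quadratic' (neg_inv_spread_re_neg hα m hbar t) _ _).const_mul _

theorem integral_etaT_mul_cexp {m hbar α : ℝ} (hm : 0 < m) (hh : 0 < hbar) (hα : 0 < α)
    (q p t κ : ℝ) :
    ∫ x : ℝ, etaT m hbar α q p t x * Complex.exp (Complex.I * κ * x) =
      Complex.exp (-Complex.I * ((hbar * t * κ ^ 2 / (2 * m) : ℝ) : ℂ)) *
        (((2 * Real.pi * α ^ 2 : ℝ) : ℂ) ^ (-(1 / 4 : ℂ)) *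
          ((4 * Real.pi * α ^ 2 : ℝ) : ℂ) ^ (1 / 2 : ℂ) *
          Complex.exp (Complex.I * κ * q - (p / hbar + κ) ^ 2 * α ^ 2)) := by
  have hw := spread_ne_zero m hbar α t
  have hα' : (α : ℂ) ≠ 0 := by exact_mod_cast hα.ne'
  have hm' : (m : ℂ) ≠ 0 := by exact_mod_cast hm.ne'
  have hh' : (hbar : ℂ) ≠ 0 := by exact_mod_cast hh.ne'
  simp_rw [etaT_mul_cexp]
  rw [integral_const_mul, integral_cexp_quadratic (neg_inv_spread_re_neg hα m hbar t),
    ← mul_sq_cpow_mul_cpow (by positivity : 0 < 2 * Real.pi * α ^ 2)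
      (by positivity : 0 < 4 * Real.pi * α ^ 2)
      (by rw [spread_re]; exact one_pos : 0 < (spread m hbar α t).re)]
  have hpi : (Real.pi : ℂ) / - -(1 / (4 * (α : ℂ) ^ 2 * spread m hbar α t)) =
      ((4 * Real.pi * α ^ 2 : ℝ) : ℂ) * spread m hbar α t := by
    push_cast
    field_simp
  rw [hpi, ← mul_assoc, mul_left_comm, ← Complex.exp_add]
  congr 2
  · push_cast; rfl
  have hD0 : 4 * (α : ℂ) ^ 2 * spread m hbar α t ≠ 0 :=
    mul_ne_zero (mul_ne_zero (by norm_num) (pow_ne_zero 2 hα')) hw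
  have hD : 4 * (α : ℂ) ^ 2 * spread m hbar α t =
      4 * (α : ℂ) ^ 2 + 2 * Complex.I * (hbar * t / m) := by
    rw [spread]; push_cast; field_simp; ring
  have hsq (D Q K d : ℂ) (h : D ≠ 0) :
      -Q ^ 2 / D - d - (2 * Q / D + Complex.I * K) ^ 2 / (4 * -(1 / D)) =
        Complex.I * Q * K - D * K ^ 2 / 4 - d := by
    have hI := Complex.I_sq
    field_simp
    linear_combination (D ^ 2 * K ^ 2) * hI
  rw [hsq _ _ _ _ hD0, hD]
  push_cast
  field_simp
  ring

theorem integral_tsum_etaT_mul_cexp {l α : ℝ} (hl : 0 < l) (hα : 0 < α) (m hbar q p t : ℝ)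
    (k : ℤ) :
    ∫ x in (-l)..l, (∑' n : ℤ, etaT m hbar α q p t (x - 2 * (n : ℝ) * l)) *
        Complex.exp (Complex.I * (Real.pi : ℂ) * (k : ℂ) * (x : ℂ) / (l : ℂ)) =
      ∫ x : ℝ, etaT m hbar α q p t x *
        Complex.exp (Complex.I * ((Real.pi * k / l : ℝ) : ℂ) * x) := by
  have hl' : (l : ℂ) ≠ 0 := by exact_mod_cast hl.ne'
  rw [← integral_tsum_comp_add_zsmul (integrable_etaT_mul_cexp hα m hbar q p t _)
    (by positivity : 0 < 2 * l) (-l), show -l + 2 * l = l by ring]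
  refine intervalIntegral.integral_congr fun x _ => ?_
  rw [← tsum_mul_right, ← (Equiv.neg ℤ).tsum_eq]
  refine tsum_congr fun n => ?_
  congr 1
  · congr 1
    simp
    ring
  · rw [Complex.exp_eq_exp_iff_exists_int]
    refine ⟨-(k * n), ?_⟩
    push_cast
    simp
    field_simp
    ring

/-- the Fourier coefficients of the evolved circle coherent state are the
spectrally evolved Fourier coefficients of `υ_{qp}` (free Hamiltonian on the circle). -/
theorem upsilonT_fourier_coeff
    (l m hbar α : ℝ) (hl : 0 < l) (hm : 0 < m) (hh : 0 < hbar) (hα : 0 < α)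
    (k : ℤ) (q p t : ℝ) :
    (∫ x in (-l)..l, upsilonT l m hbar α q p t x *
        Complex.exp (Complex.I * (Real.pi : ℂ) * (k : ℂ) * (x : ℂ) / (l : ℂ))) =
      Complex.exp (-Complex.I *
          ((hbar * t * Real.pi ^ 2 * (k : ℝ) ^ 2 / (2 * m * l ^ 2) : ℝ) : ℂ)) *
        ∫ x in (-l)..l, upsilon l hbar α q p x *
          Complex.exp (Complex.I * (Real.pi : ℂ) * (k : ℂ) * (x : ℂ) / (l : ℂ)) := by
  simp only [upsilonT, upsilon, ← etaT_zero hα m hbar q p]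
  rw [integral_tsum_etaT_mul_cexp hl hα, integral_tsum_etaT_mul_cexp hl hα,
    integral_etaT_mul_cexp hm hh hα, integral_etaT_mul_cexp hm hh hα, ← mul_assoc (Complex.exp _)
    (Complex.exp _), ← Complex.exp_add]
  congr 2
  push_cast
  field_simp
  ring
end

section
/- Let σ:ℝ²→ℝ be measurable, 2l-periodic in its first variable, with ∬_Ω |σ(q,p)| dq dp < ∞, and let g:ℝ²→ℝ be smooth, 2l-periodic in its first variable, and compactly supported in its second variable. Then lim_{t→±∞} ∬_Ω σ(q − p·t/m, p)·g(q,p) dq dp = ∬_Ω [ (1/(2l)) ∫_{−l}^{l} σ(q',p) dq' ]·g(q,p) dq dp. (Classical diffusion on the circle: the freely transported density weakly flattens in the position variable; this extends Kozlov's theorem on diffusion from L² to L¹ densities.) -/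
open MeasureTheory Filter Complex Real
open scoped ComplexConjugate Topology

section CircleFlow

variable {T : ℝ}

/-- The position on the circle `ℝ / Tℤ` after time `s` of the point `z = (q, p)` moving
with velocity `p`. -/
def circleFlow (T s : ℝ) (z : ℝ × ℝ) : AddCircle T :=
  ((z.1 + z.2 * s : ℝ) : AddCircle T)

lemma continuous_circleFlow (s : ℝ) : Continuous (circleFlow T s) :=
  (AddCircle.continuous_mk' T).comp (by fun_prop)

lemma aestronglyMeasurable_apply_circleFlow {F : ℝ × ℝ → C(AddCircle T, ℂ)}
    {μ : Measure (ℝ × ℝ)} (hF : AEStronglyMeasurable F μ) (s : ℝ) :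
    AEStronglyMeasurable (fun z => F z (circleFlow T s z)) μ :=
  (continuous_eval (F := C(AddCircle T, ℂ))).comp_aestronglyMeasurable
    (hF.prodMk (continuous_circleFlow s).aestronglyMeasurable)

/-- A continuous function periodic in its first variable is a continuous family of continuous
functions on the circle. -/
lemma exists_continuous_circle_family {g : ℝ × ℝ → ℝ} (hg : Continuous g)
    (hper : ∀ q p : ℝ, g (q + T, p) = g (q, p)) :
    ∃ G : ℝ → C(AddCircle T, ℂ), Continuous G ∧
      ∀ q p : ℝ, G p (q : AddCircle T) = (g (q, p) : ℂ) := by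
  have hp : ∀ p, Function.Periodic (fun q => (g (q, p) : ℂ)) T := fun p q => by simp [hper]
  have hcont : Continuous fun y : ℝ × AddCircle T => (hp y.1).lift y.2 := by
    have hq : IsOpenQuotientMap ((↑) : ℝ → AddCircle T) := QuotientAddGroup.isOpenQuotientMap_mk
    rw [← (IsOpenQuotientMap.id.prodMap hq).continuous_comp_iff]
    have : Continuous fun y : ℝ × ℝ => (g (y.2, y.1) : ℂ) := by fun_prop
    exact this
  exact ⟨ContinuousMap.curry ⟨_, hcont⟩, (ContinuousMap.curry ⟨_, hcont⟩).continuous,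
    fun q p => rfl⟩

/-- The mean value of a continuous function on the circle. -/
noncomputable def circleMean (T : ℝ) [hT : Fact (0 < T)] : C(AddCircle T, ℂ) →L[ℂ] ℂ :=
  LinearMap.mkContinuous
    { toFun := fun φ => ∫ x, φ x ∂AddCircle.haarAddCircle
      map_add' := fun φ ψ => integral_add
        (φ.continuous.integrable_of_hasCompactSupport (HasCompactSupport.of_compactSpace _))
        (ψ.continuous.integrable_of_hasCompactSupport (HasCompactSupport.of_compactSpace _))
      map_smul' := fun c φ => integral_const_mul c _ } 1
    (fun φ => by
      simpa using norm_integral_le_of_norm_le_const (μ := AddCircle.haarAddCircle)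
        (Eventually.of_forall φ.norm_coe_le_norm))

variable [hT : Fact (0 < T)]

lemma circleMean_eq_intervalIntegral (φ : C(AddCircle T, ℂ)) (a : ℝ) :
    circleMean T φ = (1 / T : ℝ) • ∫ x in a..a + T, φ (x : AddCircle T) := by
  have h := fourierCoeff_eq_intervalIntegral (φ : AddCircle T → ℂ) 0 a
  simpa [fourierCoeff, circleMean] using h

lemma circleMean_fourier_of_ne_zero {k : ℤ} (hk : k ≠ 0) :
    circleMean T (fourier k) = 0 :=
  integral_eq_zero_of_add_right_eq_neg (μ := AddCircle.haarAddCircle)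
    (fourier_add_half_inv_index hk hT.out)

/-- Riemann–Lebesgue lemma for the Fourier monomials transported by the free flow. -/
lemma tendsto_integral_mul_fourier_circleFlow (f : ℝ × ℝ → ℂ) {k : ℤ} (hk : k ≠ 0) :
    Tendsto (fun s : ℝ => ∫ z, f z * fourier k (circleFlow T s z)) (cocompact ℝ) (𝓝 0) := by
  have hT0 : T ≠ 0 := hT.out.ne'
  set w : StrongDual ℝ (ℝ × ℝ) := (-(k / T) : ℝ) • ContinuousLinearMap.snd ℝ ℝ ℝ with hw
  have hw0 : w ≠ 0 := by
    intro h
    have := congrArg (fun v : StrongDual ℝ (ℝ × ℝ) => v (0, 1)) h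
    simp [hw, hk, hT0] at this
  have hlim : Tendsto (fun s : ℝ => s • w) (cocompact ℝ) (cocompact _) := by
    rw [← Metric.cobounded_eq_cocompact, ← Metric.cobounded_eq_cocompact,
      ← tendsto_norm_atTop_iff_cobounded]
    simp_rw [norm_smul]
    exact tendsto_norm_cobounded_atTop.atTop_mul_const (norm_pos_iff.2 hw0)
  refine ((tendsto_integral_exp_smul_cocompact
    (fun z : ℝ × ℝ => f z * fourier k ((z.1 : ℝ) : AddCircle T)) volume).comp hlim).congr ?_
  intro s
  refine integral_congr_ae (Eventually.of_forall fun z => ?_)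
  simp only [circleFlow, fourier_coe_apply, Circle.smul_def, Real.fourierChar_apply, smul_eq_mul]
  rw [mul_left_comm, ← Complex.exp_add]
  congr 2
  simp [hw]
  field_simp
  ring

lemma integrable_apply_circleFlow {F : ℝ × ℝ → C(AddCircle T, ℂ)}
    {μ : Measure (ℝ × ℝ)} (hF : Integrable F μ) (s : ℝ) :
    Integrable (fun z => F z (circleFlow T s z)) μ :=
  hF.mono (aestronglyMeasurable_apply_circleFlow hF.1 s)
    (Eventually.of_forall fun z => (F z).norm_coe_le_norm _)

lemma norm_integral_apply_circleFlow_sub_le {F G : ℝ × ℝ → C(AddCircle T, ℂ)}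
    (hF : Integrable F) (hG : Integrable G) (s : ℝ) :
    ‖(∫ z, F z (circleFlow T s z)) - ∫ z, G z (circleFlow T s z)‖ ≤ ∫ z, ‖F z - G z‖ := by
  rw [← integral_sub (integrable_apply_circleFlow hF s) (integrable_apply_circleFlow hG s)]
  exact norm_integral_le_of_norm_le (hF.sub hG).norm
    (Eventually.of_forall fun z => (F z - G z).norm_coe_le_norm _)

lemma tendsto_integral_indicator_apply_circleFlow {A : Set (ℝ × ℝ)} (hA : MeasurableSet A)
    (hA' : volume A < ⊤) (φ : C(AddCircle T, ℂ)) :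
    Tendsto (fun s : ℝ => ∫ z, (A.indicator (fun _ => φ) z) (circleFlow T s z)) (cocompact ℝ)
      (𝓝 (circleMean T (∫ z, A.indicator (fun _ => φ) z))) := by
  have hint : ∀ ψ : C(AddCircle T, ℂ), Integrable (A.indicator fun _ => ψ) := fun ψ =>
    (integrable_indicator_iff hA).2 (integrableOn_const hA'.ne)
  have hclosed : IsClosed {ψ : C(AddCircle T, ℂ) |
      Tendsto (fun s : ℝ => ∫ z, (A.indicator (fun _ => ψ) z) (circleFlow T s z)) (cocompact ℝ)
        (𝓝 (circleMean T (∫ z, A.indicator (fun _ => ψ) z)))} := by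
    refine Equicontinuous.isClosed_setOfPred_tendsto
      (F := fun (s : ℝ) (ψ : C(AddCircle T, ℂ)) =>
        ∫ z, (A.indicator (fun _ => ψ) z) (circleFlow T s z))
      (LipschitzWith.uniformEquicontinuous _ (volume.real A).toNNReal fun s =>
        LipschitzWith.of_dist_le_mul fun ψ χ => ?_).equicontinuous ?_
    · rw [dist_eq_norm, dist_eq_norm]
      refine (norm_integral_apply_circleFlow_sub_le (hint ψ) (hint χ) s).trans_eq ?_
      have : (fun z => ‖A.indicator (fun _ => ψ) z - A.indicator (fun _ => χ) z‖) =
          A.indicator fun _ => ‖ψ - χ‖ := by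
        ext z
        by_cases hz : z ∈ A <;> simp [hz]
      rw [this, integral_indicator_const _ hA, Real.coe_toNNReal _ measureReal_nonneg, smul_eq_mul]
    · simp_rw [integral_indicator_const _ hA]
      fun_prop
  have hspan : (Submodule.span ℂ (Set.range (@fourier T)) : Set C(AddCircle T, ℂ)) ⊆
      {ψ : C(AddCircle T, ℂ) |
      Tendsto (fun s : ℝ => ∫ z, (A.indicator (fun _ => ψ) z) (circleFlow T s z)) (cocompact ℝ)
        (𝓝 (circleMean T (∫ z, A.indicator (fun _ => ψ) z)))} := by
    intro ψ hψ
    refine Submodule.span_induction ?_ ?_ ?_ ?_ hψ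
    · rintro _ ⟨k, rfl⟩
      have heq : ∀ s z, (A.indicator (fun _ => (fourier k : C(AddCircle T, ℂ))) z)
          (circleFlow T s z) = A.indicator (fun _ => (1 : ℂ)) z * fourier k (circleFlow T s z) := by
        intro s z
        by_cases hz : z ∈ A <;> simp [hz]
      simp only [Set.mem_ofPred_eq, heq]
      rcases eq_or_ne k 0 with rfl | hk
      · have h1 : circleMean T (fourier 0) = 1 := by simp [circleMean]
        simp [integral_indicator_const _ hA, h1]
      · rw [integral_indicator_const _ hA, ContinuousLinearMap.map_smul_of_tower,
          circleMean_fourier_of_ne_zero hk, smul_zero]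
        exact tendsto_integral_mul_fourier_circleFlow _ hk
    · simp
    · intro ψ χ _ _ h₁ h₂
      have heq : A.indicator (fun _ => ψ + χ) =
          A.indicator (fun _ => ψ) + A.indicator (fun _ => χ) := Set.indicator_add _ _ _
      simp only [Set.mem_ofPred_eq, heq, Pi.add_apply, ContinuousMap.add_apply]
      rw [integral_add (hint ψ) (hint χ), map_add]
      exact (h₁.add h₂).congr fun s => (integral_add (integrable_apply_circleFlow (hint ψ) s)
        (integrable_apply_circleFlow (hint χ) s)).symm
    · intro c ψ _ h
      have heq : A.indicator (fun _ => c • ψ) = c • A.indicator (fun _ => ψ) :=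
        Set.indicator_const_smul _ _ _
      simp only [Set.mem_ofPred_eq, heq, Pi.smul_apply, ContinuousMap.smul_apply]
      rw [integral_smul, map_smul]
      exact (h.const_smul c).congr fun s => (integral_smul _ _).symm
  have hmem : φ ∈ closure (Submodule.span ℂ (Set.range (@fourier T)) :
      Set C(AddCircle T, ℂ)) := by
    rw [← Submodule.topologicalClosure_coe, span_fourier_closure_eq_top]
    trivial
  exact closure_minimal hspan hclosed hmem

/-- Averaging along the free flow on the circle, for `L¹` families of continuous observables. -/
theorem tendsto_integral_apply_circleFlow {F : ℝ × ℝ → C(AddCircle T, ℂ)} (hF : Integrable F) :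
    Tendsto (fun s : ℝ => ∫ z, F z (circleFlow T s z)) (cocompact ℝ)
      (𝓝 (circleMean T (∫ z, F z))) := by
  refine Integrable.induction (fun F : ℝ × ℝ → C(AddCircle T, ℂ) =>
    Tendsto (fun s : ℝ => ∫ z, F z (circleFlow T s z)) (cocompact ℝ)
      (𝓝 (circleMean T (∫ z, F z)))) ?_ ?_ ?_ ?_ hF
  · exact fun φ A hA hA' => tendsto_integral_indicator_apply_circleFlow hA hA' φ
  · intro F G _ hF hG h₁ h₂
    simp only [Pi.add_apply, ContinuousMap.add_apply]
    rw [integral_add hF hG, map_add]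
    exact (h₁.add h₂).congr fun s => (integral_add (integrable_apply_circleFlow hF s)
      (integrable_apply_circleFlow hG s)).symm
  · refine Equicontinuous.isClosed_setOfPred_tendsto
      (F := fun (s : ℝ) (F : (ℝ × ℝ) →₁[volume] C(AddCircle T, ℂ)) =>
        ∫ z, F z (circleFlow T s z))
      (LipschitzWith.uniformEquicontinuous _ 1 fun s =>
        LipschitzWith.of_dist_le_mul fun F G => ?_).equicontinuous ?_
    · rw [dist_eq_norm, NNReal.coe_one, one_mul, L1.dist_eq_integral_dist]
      simp_rw [dist_eq_norm]
      exact norm_integral_apply_circleFlow_sub_le (L1.integrable_coeFn F) (L1.integrable_coeFn G) s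
    · exact (circleMean T).continuous.comp continuous_integral
  · intro F G hFG _ h
    rw [← integral_congr_ae hFG]
    refine h.congr fun s => integral_congr_ae ?_
    filter_upwards [hFG] with z hz
    rw [hz]

end CircleFlow

section PeriodicDensity

variable {l : ℝ} {f : ℝ × ℝ → ℝ}

lemma restrict_Icc_prod_univ (l : ℝ) :
    (volume : Measure (ℝ × ℝ)).restrict (Set.Icc (-l) l ×ˢ Set.univ) =
      (volume.restrict (Set.Ioc (-l) l)).prod volume := by
  rw [Measure.volume_eq_prod, ← Measure.prod_restrict, Measure.restrict_univ,
    Measure.restrict_congr_set Ioc_ae_eq_Icc]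

/-- Integrals over a period are invariant under translation. -/
lemma Function.Periodic.intervalIntegral_symm_comp_add_right {h : ℝ → ℝ}
    (hh : Function.Periodic h (2 * l)) (a : ℝ) :
    ∫ q in (-l)..l, h (q + a) = ∫ q in (-l)..l, h q := by
  rw [intervalIntegral.integral_comp_add_right]
  have := hh.intervalIntegral_add_eq (-l + a) (-l)
  convert this using 2 <;> ring

/-- The sheared density is integrable over a period cell. -/
lemma integrable_comp_shear (hl : 0 < l) (hf : Measurable f)
    (hper : ∀ q p : ℝ, f (q + 2 * l, p) = f (q, p))
    (hint : Integrable f ((volume.restrict (Set.Ioc (-l) l)).prod volume)) (s : ℝ) :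
    Integrable (fun z : ℝ × ℝ => f (z.1 + z.2 * s, z.2))
      ((volume.restrict (Set.Ioc (-l) l)).prod volume) := by
  have hle : -l ≤ l := by linarith
  have hm : Measurable fun z : ℝ × ℝ => f (z.1 + z.2 * s, z.2) := hf.comp (by fun_prop)
  rw [integrable_prod_iff' hm.aestronglyMeasurable]
  obtain ⟨h₁, h₂⟩ := (integrable_prod_iff' hf.aestronglyMeasurable).1 hint
  constructor
  · filter_upwards [h₁] with p hp
    have hpp : Function.Periodic (fun q => f (q, p)) (2 * l) := fun q => hper q p
    have hp' : IntervalIntegrable (fun q => f (q, p)) volume (-l) (-l + 2 * l) := by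
      rw [show -l + 2 * l = l by ring, intervalIntegrable_iff_integrableOn_Ioc_of_le hle]
      exact hp
    have := (hpp.intervalIntegrable (by linarith) hp' (-l + p * s) (l + p * s)).comp_add_right
      (p * s)
    simp only [add_sub_cancel_right] at this
    exact (intervalIntegrable_iff_integrableOn_Ioc_of_le hle).1 this
  · refine h₂.congr (Eventually.of_forall fun p => ?_)
    have hpp : Function.Periodic (fun q => ‖f (q, p)‖) (2 * l) := fun q => by simp [hper]
    have := hpp.intervalIntegral_symm_comp_add_right (p * s)
    rw [intervalIntegral.integral_of_le hle, intervalIntegral.integral_of_le hle] at this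
    exact this.symm

/-- The free flow may be moved from the density to the observable. -/
lemma integral_shear_mul_eq (hl : 0 < l) (hf : Measurable f)
    (hper : ∀ q p : ℝ, f (q + 2 * l, p) = f (q, p))
    (hint : Integrable f ((volume.restrict (Set.Ioc (-l) l)).prod volume))
    {g : ℝ × ℝ → ℝ} (hg : Continuous g) (hgper : ∀ q p : ℝ, g (q + 2 * l, p) = g (q, p))
    {C : ℝ} (hC : ∀ z, ‖g z‖ ≤ C) (s : ℝ) :
    ∫ q in (-l)..l, ∫ p : ℝ, f (q - p * s, p) * g (q, p) =
      ∫ z, f z * g (z.1 + z.2 * s, z.2) ∂(volume.restrict (Set.Ioc (-l) l)).prod volume := by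
  have hle : -l ≤ l := by linarith
  have h₁ : Integrable (fun z : ℝ × ℝ => f (z.1 - z.2 * s, z.2) * g z)
      ((volume.restrict (Set.Ioc (-l) l)).prod volume) := by
    have := integrable_comp_shear hl hf hper hint (-s)
    simp only [mul_neg, ← sub_eq_add_neg] at this
    exact this.mul_bdd hg.aestronglyMeasurable (Eventually.of_forall hC)
  have h₂ : Integrable (fun z : ℝ × ℝ => f z * g (z.1 + z.2 * s, z.2))
      ((volume.restrict (Set.Ioc (-l) l)).prod volume) :=
    hint.mul_bdd (hg.comp (by fun_prop)).aestronglyMeasurable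
      (Eventually.of_forall fun z => hC _)
  rw [intervalIntegral.integral_of_le hle, ← integral_prod _ h₁, integral_prod_symm _ h₁,
    integral_prod_symm _ h₂]
  refine integral_congr_ae (Eventually.of_forall fun p => ?_)
  have hpp : Function.Periodic (fun q => f (q - p * s, p) * g (q, p)) (2 * l) := fun q => by
    simp only [hgper, add_sub_right_comm, hper]
  have := hpp.intervalIntegral_symm_comp_add_right (p * s)
  rw [intervalIntegral.integral_of_le hle, intervalIntegral.integral_of_le hle] at this
  simpa using this.symm

/-- Averaging over the period may be moved from the density to the observable. -/
lemma integral_average_mul_eq (hl : 0 < l)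
    (hint : Integrable f ((volume.restrict (Set.Ioc (-l) l)).prod volume))
    {g : ℝ × ℝ → ℝ} (hg : Continuous g) {C : ℝ} (hC : ∀ z, ‖g z‖ ≤ C) :
    ∫ q in (-l)..l, ∫ p : ℝ, ((1 / (2 * l)) * ∫ q' in (-l)..l, f (q', p)) * g (q, p) =
      ∫ z, f z * ((1 / (2 * l)) * ∫ q in (-l)..l, g (q, z.2))
        ∂(volume.restrict (Set.Ioc (-l) l)).prod volume := by
  have hle : -l ≤ l := by linarith
  simp_rw [intervalIntegral.integral_of_le hle]
  have hS : Integrable (fun p : ℝ => ∫ q in Set.Ioc (-l) l, f (q, p)) := hint.integral_prod_right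
  have h₁ : Integrable (fun z : ℝ × ℝ =>
      ((1 / (2 * l)) * ∫ q' in Set.Ioc (-l) l, f (q', z.2)) * g z)
      ((volume.restrict (Set.Ioc (-l) l)).prod volume) :=
    ((hS.const_mul (1 / (2 * l))).comp_snd _).mul_bdd hg.aestronglyMeasurable
      (Eventually.of_forall hC)
  have hmean : StronglyMeasurable fun z : ℝ × ℝ =>
      (1 / (2 * l)) * ∫ q in Set.Ioc (-l) l, g (q, z.2) := by
    have : StronglyMeasurable fun p : ℝ => ∫ q in Set.Ioc (-l) l, g (q, p) :=
      hg.stronglyMeasurable.integral_prod_left'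
    exact (this.comp_measurable measurable_snd).const_mul _
  have h₂ : Integrable (fun z : ℝ × ℝ =>
      f z * ((1 / (2 * l)) * ∫ q in Set.Ioc (-l) l, g (q, z.2)))
      ((volume.restrict (Set.Ioc (-l) l)).prod volume) := by
    refine hint.mul_bdd (c := ‖1 / (2 * l)‖ * (C * volume.real (Set.Ioc (-l) l)))
      hmean.aestronglyMeasurable (Eventually.of_forall fun z => ?_)
    rw [norm_mul]
    gcongr
    exact norm_setIntegral_le_of_norm_le_const measure_Ioc_lt_top fun q _ => hC _
  rw [← integral_prod _ h₁, integral_prod_symm _ h₁, integral_prod_symm _ h₂]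
  refine integral_congr_ae (Eventually.of_forall fun p => ?_)
  simp only [integral_const_mul, integral_mul_const]
  ring

/-- Weak flattening of sheared periodic densities, in both time directions. -/
theorem tendsto_integral_shear_mul (hl : 0 < l) (hf : Measurable f)
    (hper : ∀ q p : ℝ, f (q + 2 * l, p) = f (q, p))
    (hint : Integrable f ((volume.restrict (Set.Ioc (-l) l)).prod volume))
    {g : ℝ × ℝ → ℝ} (hg : Continuous g) (hgper : ∀ q p : ℝ, g (q + 2 * l, p) = g (q, p))
    {R : ℝ} (hR : ∀ q p : ℝ, R ≤ |p| → g (q, p) = 0) :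
    Tendsto (fun s : ℝ => ∫ q in (-l)..l, ∫ p : ℝ, f (q - p * s, p) * g (q, p)) (cocompact ℝ)
      (𝓝 (∫ q in (-l)..l, ∫ p : ℝ,
        ((1 / (2 * l)) * ∫ q' in (-l)..l, f (q', p)) * g (q, p))) := by
  have : Fact (0 < 2 * l) := ⟨by linarith⟩
  obtain ⟨G, hG, hGg⟩ := exists_continuous_circle_family hg hgper
  have hGsupp : HasCompactSupport G := by
    refine HasCompactSupport.of_support_subset_isCompact (isCompact_Icc (a := -R) (b := R)) ?_
    intro p hp
    by_contra hpR
    refine hp (ContinuousMap.ext fun x => ?_)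
    obtain ⟨q, rfl⟩ := QuotientAddGroup.mk_surjective x
    have hRp : R ≤ |p| := by
      by_contra! h
      exact hpR (abs_le.1 h.le)
    exact (hGg q p).trans (by simp [hR q p hRp])
  obtain ⟨C, hC⟩ := hGsupp.exists_bound_of_continuous hG
  have hgC : ∀ z, ‖g z‖ ≤ C := fun ⟨q, p⟩ => by
    have := ((G p).norm_coe_le_norm (q : AddCircle (2 * l))).trans (hC p)
    rwa [hGg, Complex.norm_real] at this
  set Ω : Set (ℝ × ℝ) := Set.Ioc (-l) l ×ˢ Set.univ with hΩ
  have hΩm : MeasurableSet Ω := measurableSet_Ioc.prod MeasurableSet.univ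
  have hν : (volume.restrict (Set.Ioc (-l) l)).prod volume =
      (volume : Measure (ℝ × ℝ)).restrict Ω := by
    rw [hΩ, Measure.volume_eq_prod, ← Measure.prod_restrict, Measure.restrict_univ]
  set F : ℝ × ℝ → C(AddCircle (2 * l), ℂ) := fun z => (f z : ℂ) • G z.2 with hF
  have hFint : Integrable F ((volume : Measure (ℝ × ℝ)).restrict Ω) := by
    rw [← hν]
    exact (hint.ofReal (𝕜 := ℂ)).smul_bdd C (hG.comp continuous_snd).aestronglyMeasurable
      (Eventually.of_forall fun z => hC _)
  have key := tendsto_integral_apply_circleFlow ((integrable_indicator_iff hΩm).2 hFint)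
  have hGflow : ∀ s (z : ℝ × ℝ), G z.2 (circleFlow (2 * l) s z) =
      (g (z.1 + z.2 * s, z.2) : ℂ) := fun s z => hGg _ _
  have hflow : ∀ s, ∫ z, (Ω.indicator F z) (circleFlow (2 * l) s z) =
      ((∫ q in (-l)..l, ∫ p : ℝ, f (q - p * s, p) * g (q, p) : ℝ) : ℂ) := by
    intro s
    rw [integral_shear_mul_eq hl hf hper hint hg hgper hgC, hν, ← integral_complex_ofReal,
      ← integral_indicator hΩm]
    refine integral_congr_ae (Eventually.of_forall fun z => ?_)
    by_cases hz : z ∈ Ω <;> simp [hz, hF, hGflow]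
  have hlim : circleMean (2 * l) (∫ z, Ω.indicator F z) =
      ((∫ q in (-l)..l, ∫ p : ℝ,
        ((1 / (2 * l)) * ∫ q' in (-l)..l, f (q', p)) * g (q, p) : ℝ) : ℂ) := by
    rw [integral_average_mul_eq hl hint hg hgC, hν, integral_indicator hΩm,
      ← ContinuousLinearMap.integral_comp_comm _ hFint, ← integral_complex_ofReal]
    refine integral_congr_ae (Eventually.of_forall fun z => ?_)
    have hmean : circleMean (2 * l) (G z.2) =
        (((1 / (2 * l)) * ∫ q in (-l)..l, g (q, z.2) : ℝ) : ℂ) := by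
      rw [circleMean_eq_intervalIntegral _ (-l), show -l + 2 * l = l by ring,
        Complex.ofReal_mul, ← intervalIntegral.integral_ofReal, Complex.real_smul]
      simp_rw [hGg]
    simp only [hF, ContinuousLinearMap.map_smul, hmean, smul_eq_mul, Complex.ofReal_mul]
  simp_rw [hflow, hlim] at key
  exact (Complex.continuous_re.tendsto _).comp key

end PeriodicDensity

/-- classical diffusion on the circle (Kozlov-type theorem for `L¹`
densities): the freely transported density weakly flattens in the position variable
as `t → ±∞`. -/
theorem classical_diffusion_circle
    (l m : ℝ) (hl : 0 < l) (hm : 0 < m)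
    (σ : ℝ × ℝ → ℝ) (hσ_meas : Measurable σ)
    (hσ_per : ∀ q p : ℝ, σ (q + 2 * l, p) = σ (q, p))
    (hσ_int : IntegrableOn σ (Set.Icc (-l) l ×ˢ (Set.univ : Set ℝ)))
    (g : ℝ × ℝ → ℝ) (hg_smooth : ContDiff ℝ (⊤ : ℕ∞) g)
    (hg_per : ∀ q p : ℝ, g (q + 2 * l, p) = g (q, p))
    (hg_supp : ∃ R : ℝ, ∀ q p : ℝ, R ≤ |p| → g (q, p) = 0) :
    Tendsto (fun t : ℝ => ∫ q in (-l)..l, ∫ p : ℝ, σ (q - p * t / m, p) * g (q, p))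
        atTop (𝓝 (∫ q in (-l)..l, ∫ p : ℝ,
          ((1 / (2 * l)) * ∫ q' in (-l)..l, σ (q', p)) * g (q, p))) ∧
      Tendsto (fun t : ℝ => ∫ q in (-l)..l, ∫ p : ℝ, σ (q - p * t / m, p) * g (q, p))
        atBot (𝓝 (∫ q in (-l)..l, ∫ p : ℝ,
          ((1 / (2 * l)) * ∫ q' in (-l)..l, σ (q', p)) * g (q, p))) := by
  obtain ⟨R, hR⟩ := hg_supp
  have hσ_cell : Integrable σ ((volume.restrict (Set.Ioc (-l) l)).prod volume) := by
    rw [← restrict_Icc_prod_univ]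
    exact hσ_int
  have key := tendsto_integral_shear_mul hl hσ_meas hσ_per hσ_cell hg_smooth.continuous hg_per hR
  simp_rw [mul_div_assoc]
  exact ⟨key.comp ((tendsto_id.atTop_div_const hm).mono_right atTop_le_cocompact),
    key.comp ((tendsto_id.atBot_div_const hm).mono_right atBot_le_cocompact)⟩
end
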